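/- If f(z) = Σ_{n=0}^∞ a_n z^n is analytic in the open unit disk 𝔻 with |f(z)| ≤ 1 for all z ∈ 𝔻, then for every r with 0 ≤ r ≤ 1/2 one has |a_0|² + Σ_{n=1}^∞ |a_n| r^n + (1/(1+|a_0|) + r/(1-r)) · Σ_{n=1}^∞ |a_n|² r^{2n} ≤ 1. -/

import Mathlib

open MeasureTheory AddCircle in
theorem integral_fourier_haar (n : ℤ) :
    ∫ x : UnitAddCircle, fourier n x ∂haarAddCircle = if n = 0 then 1 else 0 := by
  have h := congrFun (fourierCoeff_fourier (T := 1) n) 0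
  simp only [fourierCoeff, neg_zero, fourier_zero, one_smul] at h
  rw [h, Pi.single_apply]
  simp only [eq_comm]

/-- The integral over the circle, as a linear functional on continuous functions. -/
noncomputable def circleMean : C(UnitAddCircle, ℂ) →ₗ[ℂ] ℂ where
  toFun F := ∫ x, F x ∂AddCircle.haarAddCircle
  map_add' F G := MeasureTheory.integral_add
    (F.continuous.integrable_of_hasCompactSupport (HasCompactSupport.of_compactSpace _))
    (G.continuous.integrable_of_hasCompactSupport (HasCompactSupport.of_compactSpace _))
  map_smul' c _ := MeasureTheory.integral_const_mul c _

theorem circleMean_fourier (n : ℤ) : circleMean (fourier n) = if n = 0 then 1 else 0 :=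
  integral_fourier_haar n

theorem norm_circleMean_le (F : C(UnitAddCircle, ℂ)) : ‖circleMean F‖ ≤ ‖F‖ := by
  have h := MeasureTheory.norm_integral_le_of_norm_le_const (f := F)
    (μ := (AddCircle.haarAddCircle : MeasureTheory.Measure UnitAddCircle))
    (Filter.Eventually.of_forall F.norm_coe_le_norm)
  rwa [MeasureTheory.probReal_univ, mul_one] at h

theorem re_circleMean_mono {F G : C(UnitAddCircle, ℂ)} (h : ∀ x, (F x).re ≤ (G x).re) :
    (circleMean F).re ≤ (circleMean G).re := by
  have hi (F : C(UnitAddCircle, ℂ)) : MeasureTheory.Integrable F AddCircle.haarAddCircle :=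
    F.continuous.integrable_of_hasCompactSupport (HasCompactSupport.of_compactSpace _)
  have hre (F : C(UnitAddCircle, ℂ)) :
      (circleMean F).re = ∫ x, (F x).re ∂AddCircle.haarAddCircle :=
    (integral_re (hi F)).symm
  rw [hre, hre]
  exact MeasureTheory.integral_mono (hi F).re (hi G).re h

theorem fourier_mul_fourier (m n : ℤ) :
    (fourier m * fourier n : C(UnitAddCircle, ℂ)) = fourier (m + n) := by
  ext x
  exact fourier_add.symm

theorem fourier_natCast_eq_pow (n : ℕ) (x : UnitAddCircle) :
    fourier (n : ℤ) x = fourier 1 x ^ n := by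
  induction n with
  | zero => simp
  | succ n ih => rw [pow_succ, ← ih, ← fourier_add]; rfl

theorem circleMean_mul_fourier {c : ℕ → ℂ} {F : C(UnitAddCircle, ℂ)}
    (hF : HasSum (fun n : ℕ => c n • (fourier (n : ℤ) : C(UnitAddCircle, ℂ))) F) (j m : ℕ) :
    circleMean (F * fourier ((m : ℤ) - j)) = if m ≤ j then c (j - m) else 0 := by
  have h := (hF.mul_right (fourier ((m : ℤ) - j))).map
    (circleMean.mkContinuous 1 (fun F => by simpa using norm_circleMean_le F))
    (ContinuousLinearMap.continuous _)
  have h1 : (circleMean.mkContinuous 1 (fun F => by simpa using norm_circleMean_le F)) ∘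
      (fun n : ℕ => c n • (fourier (n : ℤ) : C(UnitAddCircle, ℂ)) * fourier ((m : ℤ) - j)) =
      fun n => if m + n = j then c n else 0 := by
    funext n
    simp only [Function.comp_apply, LinearMap.mkContinuous_apply, smul_mul_assoc,
      fourier_mul_fourier, map_smul, circleMean_fourier, smul_eq_mul, mul_ite, mul_one, mul_zero]
    congr 1
    simp only [eq_iff_iff]
    omega
  rw [h1] at h
  refine h.unique ?_
  split_ifs with hmj
  · convert hasSum_ite_eq (j - m) (c (j - m)) using 2 with n
    by_cases hn : n = j - m
    · subst hn; simp [hmj]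
    · rw [if_neg (by omega), if_neg hn]
  · convert hasSum_zero (α := ℂ) (β := ℕ) using 2 with n
    rw [if_neg (by omega)]

theorem re_toeplitz_form_le {c : ℕ → ℂ} (hc : Summable fun n => ‖c n‖)
    (hb : ∀ z : ℂ, ‖z‖ = 1 → ‖∑' n, c n * z ^ n‖ ≤ 1) (m : ℕ) (s : Finset ℕ) (u : ℕ → ℂ) :
    (∑ k ∈ s, ∑ l ∈ s, if m ≤ k + l then u k * u l * c (k + l - m) else 0).re ≤
      ∑ k ∈ s, ‖u k‖ ^ 2 := by
  have hs : Summable fun n : ℕ => c n • (fourier (n : ℤ) : C(UnitAddCircle, ℂ)) := by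
    refine Summable.of_norm ?_
    simpa [norm_smul, fourier_norm] using hc
  obtain ⟨F, hF⟩ := hs
  have hF1 (x : UnitAddCircle) : ‖F x‖ ≤ 1 := by
    have h := hF.map (ContinuousMap.evalCLM ℂ x) (ContinuousLinearMap.continuous _)
    have h2 : F x = ∑' n, c n * (fourier 1 x) ^ n := by
      rw [← (show _ = F x from h.tsum_eq)]
      congr with n
      simp only [← fourier_natCast_eq_pow]
      rfl
    rw [h2]
    exact hb _ (Circle.norm_coe _)
  let V : C(UnitAddCircle, ℂ) := ∑ k ∈ s, u k • fourier ((m : ℤ) - k)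
  let W : C(UnitAddCircle, ℂ) := ∑ k ∈ s, star (u k) • fourier ((k : ℤ) - m)
  have hVW (x) : W x = star (V x) := by
    simp only [V, W, ContinuousMap.sum_apply, star_sum, ContinuousMap.smul_apply, smul_eq_mul,
      star_mul']
    refine Finset.sum_congr rfl fun k _ => ?_
    rw [← neg_sub, fourier_neg]; rfl
  have key := re_circleMean_mono (F := F * fourier (-m : ℤ) * V * V) (G := V * W) (fun x => by
    have h1 : (V * W) x = ((‖V x‖ ^ 2 : ℝ) : ℂ) := by
      rw [ContinuousMap.mul_apply, hVW]
      simpa using Complex.mul_conj' (V x)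
    rw [h1, Complex.ofReal_re]
    refine (Complex.re_le_norm _).trans ?_
    simp only [ContinuousMap.mul_apply, norm_mul]
    have h2 : ‖(fourier (-m : ℤ) : C(UnitAddCircle, ℂ)) x‖ = 1 := Circle.norm_coe _
    rw [h2]
    nlinarith [hF1 x, mul_self_nonneg ‖V x‖])
  have hL : circleMean (F * fourier (-m : ℤ) * V * V) =
      ∑ k ∈ s, ∑ l ∈ s, if m ≤ k + l then u k * u l * c (k + l - m) else 0 := by
    simp only [V, Finset.mul_sum, Finset.sum_mul, map_sum]
    rw [Finset.sum_comm]
    refine Finset.sum_congr rfl fun k _ => Finset.sum_congr rfl fun l _ => ?_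
    have h3 : F * fourier (-m : ℤ) * u k • fourier ((m : ℤ) - k) * u l • fourier ((m : ℤ) - l) =
        (u k * u l) • (F * fourier ((m : ℤ) - (k + l : ℕ))) := by
      simp only [mul_smul_comm, smul_mul_assoc, smul_smul, mul_assoc, fourier_mul_fourier]
      rw [mul_comm (u l)]
      congr 3
      push_cast; ring
    rw [h3, map_smul, circleMean_mul_fourier hF]
    simp
  have hR : circleMean (V * W) = ((∑ k ∈ s, ‖u k‖ ^ 2 : ℝ) : ℂ) := by
    simp only [V, W, Finset.mul_sum, Finset.sum_mul, map_sum, Complex.ofReal_sum]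
    refine Finset.sum_congr rfl fun k hk => ?_
    rw [Finset.sum_eq_single k]
    · simp only [mul_smul_comm, smul_mul_assoc, smul_smul, fourier_mul_fourier, map_smul,
        circleMean_fourier]
      simpa using Complex.conj_mul' (u k)
    · intro l _ hl
      simp only [mul_smul_comm, smul_mul_assoc, smul_smul, fourier_mul_fourier, map_smul,
        circleMean_fourier]
      rw [if_neg (by omega), smul_zero]
    · exact fun h => (h hk).elim
  rw [hL, hR, Complex.ofReal_re] at key
  exact key

theorem exists_sq_mul_eq_norm (z : ℂ) : ∃ η : ℂ, ‖η‖ = 1 ∧ η ^ 2 * z = ‖z‖ := by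
  refine ⟨Complex.exp ((-(z.arg / 2) : ℝ) * Complex.I), Complex.norm_exp_ofReal_mul_I _, ?_⟩
  nth_rewrite 2 [← Complex.norm_mul_exp_arg_mul_I z]
  rw [← Complex.exp_nat_mul, mul_left_comm, ← Complex.exp_add]
  have h : ((2 : ℕ) : ℂ) * ((-(z.arg / 2) : ℝ) * Complex.I) + z.arg * Complex.I = 0 := by
    push_cast; ring
  rw [h, Complex.exp_zero, mul_one]

theorem norm_coeff_add_weighted_le {c : ℕ → ℂ} (hc : Summable fun n => ‖c n‖)
    (hb : ∀ z : ℂ, ‖z‖ = 1 → ‖∑' n, c n * z ^ n‖ ≤ 1) {n m : ℕ} (hnm : n < m) (t : ℕ → ℝ) :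
    ‖c m‖ + 2 * ∑ k ∈ Finset.range (n + 1), t k * ‖c k‖ ^ 2 ≤
      1 + ∑ k ∈ Finset.range (n + 1), t k ^ 2 * ‖c k‖ ^ 2 +
      ‖∑ k ∈ Finset.range (n + 1), ∑ l ∈ Finset.range (n + 1),
        if m ≤ k + l then (t k * star (c k)) * (t l * star (c l)) * c (k + l - m) else 0‖ := by
  obtain ⟨η, hη, hηm⟩ := exists_sq_mul_eq_norm (c m)
  set B := ∑ k ∈ Finset.range (n + 1), ∑ l ∈ Finset.range (n + 1),
        if m ≤ k + l then (t k * star (c k)) * (t l * star (c l)) * c (k + l - m) else 0 with hB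
  have hηη : η * star η = 1 := by
    have := Complex.mul_conj' η
    rw [hη] at this
    simpa using this
  let u : ℕ → ℂ := fun k => if k = m then η else star η * (t k * star (c k))
  have hum : u m = η := if_pos rfl
  have hu {k : ℕ} (hk : k ∈ Finset.range (n + 1)) : u k = star η * (t k * star (c k)) :=
    if_neg (by rw [Finset.mem_range] at hk; omega)
  have hcross {k : ℕ} (hk : k ∈ Finset.range (n + 1)) :
      η * u k * c k = ((t k * ‖c k‖ ^ 2 : ℝ) : ℂ) := by
    have h1 : star (c k) * c k = ‖c k‖ ^ 2 := Complex.conj_mul' (c k)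
    rw [hu hk]
    push_cast
    rw [← h1]
    linear_combination (t k * star (c k) * c k) * hηη
  have hm : m ∉ Finset.range (n + 1) := by simpa using hnm
  have key := re_toeplitz_form_le hc hb m (insert m (Finset.range (n + 1))) u
  simp only [Finset.sum_insert hm, hum, hη] at key
  have h1 : ∀ k ∈ Finset.range (n + 1),
      (if m ≤ m + k then η * u k * c (m + k - m) else 0) = ((t k * ‖c k‖ ^ 2 : ℝ) : ℂ) := by
    intro k hk
    rw [if_pos (by omega), Nat.add_sub_cancel_left, hcross hk]
  have h2 : ∀ k ∈ Finset.range (n + 1), (if m ≤ k + m then u k * η * c (k + m - m) else 0) =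
      ((t k * ‖c k‖ ^ 2 : ℝ) : ℂ) := by
    intro k hk
    rw [if_pos (by omega), Nat.add_sub_cancel, mul_comm (u k), hcross hk]
  have h3 : (∑ k ∈ Finset.range (n + 1), ∑ l ∈ Finset.range (n + 1),
      if m ≤ k + l then u k * u l * c (k + l - m) else 0) = star η ^ 2 * B := by
    rw [hB, Finset.mul_sum]
    refine Finset.sum_congr rfl fun k hk => ?_
    rw [Finset.mul_sum]
    refine Finset.sum_congr rfl fun l hl => ?_
    rw [hu hk, hu hl]
    split_ifs
    · ring
    · simp
  have h4 : ∀ k ∈ Finset.range (n + 1), ‖u k‖ ^ 2 = t k ^ 2 * ‖c k‖ ^ 2 := by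
    intro k hk
    rw [hu hk, norm_mul, norm_mul, norm_star, norm_star, hη, Complex.norm_real, one_mul,
      mul_pow, Real.norm_eq_abs, sq_abs]
  have h5 : η * η * c (m + m - m) = ((‖c m‖ : ℝ) : ℂ) := by
    rw [Nat.add_sub_cancel, ← sq, hηm]
  rw [Finset.sum_congr rfl h1, Finset.sum_add_distrib, Finset.sum_congr rfl h2, h3,
    Finset.sum_congr rfl h4, if_pos (by omega), h5, ← Complex.ofReal_sum] at key
  simp only [Complex.add_re, Complex.ofReal_re] at key
  have h6 : -‖B‖ ≤ (star η ^ 2 * B).re := by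
    have h := Complex.abs_re_le_norm (star η ^ 2 * B)
    rw [norm_mul, norm_pow, norm_star, hη, one_pow, one_mul] at h
    exact (abs_le.mp h).1
  linarith

theorem norm_coeff_odd_le {c : ℕ → ℂ} (hc : Summable fun n => ‖c n‖)
    (hb : ∀ z : ℂ, ‖z‖ = 1 → ‖∑' n, c n * z ^ n‖ ≤ 1) (n : ℕ) :
    ‖c (2 * n + 1)‖ ≤ 1 - ∑ k ∈ Finset.range (n + 1), ‖c k‖ ^ 2 := by
  have key := norm_coeff_add_weighted_le hc hb (n := n) (m := 2 * n + 1) (by omega) fun _ => 1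
  rw [Finset.sum_eq_zero (f := fun k => ∑ l ∈ Finset.range (n + 1), _)] at key
  · simp only [one_mul, one_pow, norm_zero] at key
    linarith
  · intro k hk
    refine Finset.sum_eq_zero fun l hl => if_neg ?_
    rw [Finset.mem_range] at hk hl
    omega

theorem norm_coeff_even_le {c : ℕ → ℂ} (hc : Summable fun n => ‖c n‖)
    (hb : ∀ z : ℂ, ‖z‖ = 1 → ‖∑' n, c n * z ^ n‖ ≤ 1) (n : ℕ) :
    ‖c (2 * n + 2)‖ ≤ 1 - ∑ k ∈ Finset.range (n + 1), ‖c k‖ ^ 2 -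
      1 / (1 + ‖c 0‖) * ‖c (n + 1)‖ ^ 2 := by
  set β := 1 / (1 + ‖c 0‖) with hβ
  have hβ' : β * (1 + ‖c 0‖) = 1 := one_div_mul_cancel (by positivity)
  have hβ0 : 0 < β := by positivity
  have key := norm_coeff_add_weighted_le hc hb (n := n + 1) (m := 2 * n + 2) (by omega)
    fun k => if k = n + 1 then β else 1
  have hmem : n + 1 ∈ Finset.range (n + 1 + 1) := Finset.self_mem_range_succ _
  rw [Finset.sum_eq_single_of_mem (f := fun k => ∑ l ∈ Finset.range (n + 1 + 1), _) _ hmem,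
    Finset.sum_eq_single_of_mem (f := fun l => if 2 * n + 2 ≤ n + 1 + l then _ else _) _ hmem,
    if_pos (by omega), show n + 1 + (n + 1) - (2 * n + 2) = 0 by omega,
    Finset.sum_range_succ _ (n + 1), Finset.sum_range_succ _ (n + 1), if_pos rfl] at key
  · have h (p : ℕ) : ∑ k ∈ Finset.range (n + 1), (if k = n + 1 then β else 1) ^ p * ‖c k‖ ^ 2 =
        ∑ k ∈ Finset.range (n + 1), ‖c k‖ ^ 2 := by
      refine Finset.sum_congr rfl fun k hk => ?_
      rw [if_neg (by rw [Finset.mem_range] at hk; omega), one_pow, one_mul]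
    have h1 := h 1
    simp only [pow_one] at h1
    rw [h1, h 2] at key
    simp only [norm_mul, norm_star, Complex.norm_real, Real.norm_eq_abs, abs_of_pos hβ0] at key
    have : β ^ 2 * ‖c (n + 1)‖ ^ 2 + β * ‖c (n + 1)‖ * (β * ‖c (n + 1)‖) * ‖c 0‖ =
        β * ‖c (n + 1)‖ ^ 2 := by
      linear_combination β * ‖c (n + 1)‖ ^ 2 * hβ'
    linarith
  · intro l hl hne
    rw [Finset.mem_range] at hl
    exact if_neg (by omega)
  · intro k hk hne
    refine Finset.sum_eq_zero fun l hl => if_neg ?_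
    rw [Finset.mem_range] at hk hl
    omega

theorem summable_norm_and_norm_tsum_le_of_dilation {f : ℂ → ℂ} {a : ℕ → ℂ}
    (hf : ∀ z : ℂ, ‖z‖ < 1 → HasSum (fun n : ℕ => a n * z ^ n) (f z))
    (hb : ∀ z : ℂ, ‖z‖ < 1 → ‖f z‖ ≤ 1) {ρ : ℝ} (hρ0 : 0 ≤ ρ) (hρ1 : ρ < 1) :
    (Summable fun n => ‖a n * (ρ : ℂ) ^ n‖) ∧
      ∀ z : ℂ, ‖z‖ = 1 → ‖∑' n, a n * (ρ : ℂ) ^ n * z ^ n‖ ≤ 1 := by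
  have hρ : ‖(ρ : ℂ)‖ < 1 := by rwa [Complex.norm_real, Real.norm_of_nonneg hρ0]
  refine ⟨(hf ρ hρ).summable.norm, fun z hz => ?_⟩
  have hz' : ‖(ρ : ℂ) * z‖ < 1 := by rwa [norm_mul, hz, mul_one]
  have h := (hf _ hz').tsum_eq
  simp only [mul_pow, ← mul_assoc] at h
  rw [h]
  exact hb _ hz'

theorem norm_powerSeries_coeff_le {f : ℂ → ℂ} {a : ℕ → ℂ}
    (hf : ∀ z : ℂ, ‖z‖ < 1 → HasSum (fun n : ℕ => a n * z ^ n) (f z))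
    (hb : ∀ z : ℂ, ‖z‖ < 1 → ‖f z‖ ≤ 1) (n : ℕ) :
    ‖a (2 * n + 1)‖ ≤ 1 - ∑ k ∈ Finset.range (n + 1), ‖a k‖ ^ 2 ∧
    ‖a (2 * n + 2)‖ ≤ 1 - ∑ k ∈ Finset.range (n + 1), ‖a k‖ ^ 2 -
      1 / (1 + ‖a 0‖) * ‖a (n + 1)‖ ^ 2 := by
  let d : ℝ → ℕ → ℂ := fun ρ k => a k * (ρ : ℂ) ^ k
  have hd (k : ℕ) : Filter.Tendsto (fun ρ => ‖d ρ k‖) (nhdsWithin 1 (Set.Ioo 0 1))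
      (nhds ‖a k‖) := by
    have h : Continuous fun ρ => ‖d ρ k‖ := by fun_prop
    simpa [d] using (h.tendsto 1).mono_left nhdsWithin_le_nhds
  have hd0 (ρ : ℝ) : d ρ 0 = a 0 := by simp [d]
  have hne : (nhdsWithin (1 : ℝ) (Set.Ioo 0 1)).NeBot :=
    right_nhdsWithin_Ioo_neBot one_pos
  have hS : Filter.Tendsto (fun ρ => ∑ k ∈ Finset.range (n + 1), ‖d ρ k‖ ^ 2)
      (nhdsWithin 1 (Set.Ioo 0 1)) (nhds (∑ k ∈ Finset.range (n + 1), ‖a k‖ ^ 2)) :=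
    tendsto_finsetSum _ fun k _ => (hd k).pow 2
  constructor
  · refine le_of_tendsto_of_tendsto (hd _) (hS.const_sub 1) ?_
    filter_upwards [self_mem_nhdsWithin] with ρ hρ
    obtain ⟨h1, h2⟩ := summable_norm_and_norm_tsum_le_of_dilation hf hb hρ.1.le hρ.2
    exact norm_coeff_odd_le h1 h2 n
  · refine le_of_tendsto_of_tendsto (hd _)
      ((hS.const_sub 1).sub (((hd (n + 1)).pow 2).const_mul (1 / (1 + ‖a 0‖)))) ?_
    filter_upwards [self_mem_nhdsWithin] with ρ hρ
    obtain ⟨h1, h2⟩ := summable_norm_and_norm_tsum_le_of_dilation hf hb hρ.1.le hρ.2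
    have h := norm_coeff_even_le h1 h2 n
    rwa [show a 0 * (ρ : ℂ) ^ 0 = a 0 from hd0 ρ] at h

theorem bohr_partial_sum_le {x : ℕ → ℝ} {β r : ℝ} (hr0 : 0 ≤ r) (hr1 : r < 1)
    (hodd : ∀ n, x (2 * n + 1) ≤ 1 - ∑ k ∈ Finset.range (n + 1), x k ^ 2)
    (heven : ∀ n, x (2 * n + 2) ≤
      1 - ∑ k ∈ Finset.range (n + 1), x k ^ 2 - β * x (n + 1) ^ 2) (N : ℕ) :
    ∑ n ∈ Finset.range (2 * N), x (n + 1) * r ^ (n + 1) +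
      (β + r / (1 - r)) * ∑ n ∈ Finset.range N, x (n + 1) ^ 2 * r ^ (2 * (n + 1)) ≤
    (1 - x 0 ^ 2) * (r / (1 - r)) -
      (1 - ∑ k ∈ Finset.range (N + 1), x k ^ 2) * (r ^ (2 * N) * (r / (1 - r))) := by
  have hq : r / (1 - r) * (1 - r) = r := div_mul_cancel₀ _ (by linarith)
  generalize r / (1 - r) = q at hq ⊢
  induction N with
  | zero => simp
  | succ N ih =>
    rw [show 2 * (N + 1) = 2 * N + 1 + 1 by ring, Finset.sum_range_succ _ (2 * N + 1),
      Finset.sum_range_succ _ (2 * N), Finset.sum_range_succ _ N,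
      Finset.sum_range_succ _ (N + 1)]
    have h1 := mul_le_mul_of_nonneg_right (hodd N) (pow_nonneg hr0 (2 * N + 1))
    have h2 := mul_le_mul_of_nonneg_right (heven N) (pow_nonneg hr0 (2 * N + 2))
    generalize ∑ k ∈ Finset.range (N + 1), x k ^ 2 = S at ih h1 h2 ⊢
    have h3 : (1 - S) * (r ^ (2 * N) * q) - (1 - S - x (N + 1) ^ 2) * (r ^ (2 * N + 2) * q) =
        (1 - S) * (r ^ (2 * N + 1) + r ^ (2 * N + 2)) + x (N + 1) ^ 2 * r ^ (2 * N + 2) * q := by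
      linear_combination (1 - S) * r ^ (2 * N) * (1 + r) * hq
    generalize ∑ n ∈ Finset.range (2 * N), x (n + 1) * r ^ (n + 1) = A at ih ⊢
    generalize ∑ n ∈ Finset.range N, x (n + 1) ^ 2 * r ^ (2 * (n + 1)) = B at ih ⊢
    ring_nf at ih h1 h2 h3 ⊢
    linarith

/-- If `f(z) = Σ aₙ zⁿ` is analytic in the unit disk with `|f| ≤ 1`, then for `0 ≤ r ≤ 1/2`,
`|a₀|² + Σ_{n≥1} |aₙ| rⁿ + (1/(1+|a₀|) + r/(1-r)) Σ_{n≥1} |aₙ|² r^{2n} ≤ 1`. -/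
theorem stmt_4 (f : ℂ → ℂ) (a : ℕ → ℂ)
    (hf : ∀ z : ℂ, ‖z‖ < 1 → HasSum (fun n : ℕ => a n * z ^ n) (f z))
    (hb : ∀ z : ℂ, ‖z‖ < 1 → ‖f z‖ ≤ 1)
    (r : ℝ) (hr0 : 0 ≤ r) (hr1 : r ≤ 1 / 2) :
    ‖a 0‖ ^ 2 + (∑' n : ℕ, ‖a (n + 1)‖ * r ^ (n + 1)) +
      (1 / (1 + ‖a 0‖) + r / (1 - r)) *
        ∑' n : ℕ, ‖a (n + 1)‖ ^ 2 * r ^ (2 * (n + 1)) ≤ 1 := by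
  have hcoeff := norm_powerSeries_coeff_le hf hb
  have hS (n : ℕ) : ∑ k ∈ Finset.range (n + 1), ‖a k‖ ^ 2 ≤ 1 := by
    linarith [(hcoeff n).1, norm_nonneg (a (2 * n + 1))]
  have ha (n : ℕ) : ‖a n‖ ^ 2 ≤ 1 :=
    (Finset.single_le_sum (f := fun k => ‖a k‖ ^ 2) (fun _ _ => by positivity)
      (Finset.self_mem_range_succ n)).trans (hS n)
  have hr : r < 1 := by linarith
  have hs1 : Summable fun n : ℕ => ‖a (n + 1)‖ * r ^ (n + 1) := by
    have h := (summable_nat_add_iff 1).mpr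
      (summable_norm_and_norm_tsum_le_of_dilation hf hb hr0 hr).1
    simpa [abs_of_nonneg hr0] using h
  have hs2 : Summable fun n : ℕ => ‖a (n + 1)‖ ^ 2 * r ^ (2 * (n + 1)) := by
    refine Summable.of_nonneg_of_le (fun n => by positivity) (fun n => ?_)
      (summable_geometric_of_lt_one hr0 hr)
    calc ‖a (n + 1)‖ ^ 2 * r ^ (2 * (n + 1)) ≤ 1 * r ^ (2 * (n + 1)) := by
          gcongr; exact ha _
      _ ≤ r ^ n := by
          rw [one_mul]; exact pow_le_pow_of_le_one hr0 hr.le (by omega)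
  have hq0 : 0 ≤ r / (1 - r) := div_nonneg hr0 (by linarith)
  have hq1 : r / (1 - r) ≤ 1 := (div_le_one (by linarith)).mpr (by linarith)
  have hlim := (hs1.hasSum.tendsto_sum_nat.comp
      (Filter.tendsto_id.const_mul_atTop' (two_pos : 0 < 2))).add
    (hs2.hasSum.tendsto_sum_nat.const_mul (1 / (1 + ‖a 0‖) + r / (1 - r)))
  have hle := le_of_tendsto' hlim (b := (1 - ‖a 0‖ ^ 2) * 1) fun N => by
    refine (bohr_partial_sum_le (x := fun k => ‖a k‖) hr0 hr (fun n => (hcoeff n).1)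
      (fun n => (hcoeff n).2) N).trans ?_
    have h1 : 0 ≤ (1 - ∑ k ∈ Finset.range (N + 1), ‖a k‖ ^ 2) * (r ^ (2 * N) * (r / (1 - r))) :=
      mul_nonneg (sub_nonneg.mpr (hS N)) (by positivity)
    have h2 := mul_le_mul_of_nonneg_left hq1 (sub_nonneg.mpr (ha 0))
    linarith
  linarith
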